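/- (Magnetic Hardy inequality of Laptev–Weidl type.) Let x₀ ∈ ℝ², R > 0, ν ∈ ℝ, and let u ∈ C^∞(ℝ², ℂ) vanish on a neighborhood of x₀. Then ∫_{B(x₀,R)} |∇u(x) − i u(x) A_{x₀,ν}(x)|² dx ≥ d(ν,ℤ)² · ∫_{B(x₀,R)} |u(x)|²/|x−x₀|² dx. -/

import Mathlib

open MeasureTheory

noncomputable def AB (x₀ : EuclideanSpace ℝ (Fin 2)) (ν : ℝ)
    (x : EuclideanSpace ℝ (Fin 2)) : Fin 2 → ℝ := fun i =>
  if i = 0 then -ν * (x 1 - x₀ 1) / ‖x - x₀‖ ^ 2 else ν * (x 0 - x₀ 0) / ‖x - x₀‖ ^ 2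

noncomputable def magGradSq (A : EuclideanSpace ℝ (Fin 2) → Fin 2 → ℝ)
    (u : EuclideanSpace ℝ (Fin 2) → ℂ) (x : EuclideanSpace ℝ (Fin 2)) : ℝ :=
  ∑ i : Fin 2, ‖fderiv ℝ u x (EuclideanSpace.single i 1) - Complex.I * u x * (A x i)‖ ^ 2

def VanishesNear (x₀ : EuclideanSpace ℝ (Fin 2)) (u : EuclideanSpace ℝ (Fin 2) → ℂ) : Prop :=
  ∃ ε > 0, ∀ x ∈ Metric.ball x₀ ε, u x = 0

noncomputable def lambda1 (x₀ : EuclideanSpace ℝ (Fin 2)) (ν : ℝ)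
    (D : Set (EuclideanSpace ℝ (Fin 2))) : ℝ :=
  sInf {q | ∃ u : EuclideanSpace ℝ (Fin 2) → ℂ, ContDiff ℝ (⊤ : ℕ∞) u ∧ VanishesNear x₀ u ∧
    0 < ∫ x in D, ‖u x‖ ^ 2 ∧
    q = (∫ x in D, magGradSq (AB x₀ ν) u x) / ∫ x in D, ‖u x‖ ^ 2}

noncomputable def sigma1 (x₀ : EuclideanSpace ℝ (Fin 2)) (ν : ℝ)
    (D : Set (EuclideanSpace ℝ (Fin 2))) : ℝ :=
  sInf {q | ∃ u : EuclideanSpace ℝ (Fin 2) → ℂ, ContDiff ℝ (⊤ : ℕ∞) u ∧ VanishesNear x₀ u ∧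
    0 < ∫ x in frontier D, ‖u x‖ ^ 2 ∂(μH[1]) ∧
    q = (∫ x in D, magGradSq (AB x₀ ν) u x) / ∫ x in frontier D, ‖u x‖ ^ 2 ∂(μH[1])}

def HasSmoothBoundary {E : Type*} [NormedAddCommGroup E] [NormedSpace ℝ E] (Ω : Set E) : Prop :=
  ∀ x ∈ frontier Ω, ∃ (f : E → ℝ) (ε : ℝ), 0 < ε ∧ ContDiff ℝ (⊤ : ℕ∞) f ∧
    fderiv ℝ f x ≠ 0 ∧ ∀ y ∈ Metric.ball x ε, (y ∈ Ω ↔ f y < 0)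

noncomputable def distInt (ν : ℝ) : ℝ := ⨅ k : ℤ, |ν - (k : ℝ)|

lemma distInt_sq_le (ν : ℝ) (n : ℤ) : distInt ν ^ 2 ≤ (n - ν) ^ 2 := by
  have h0 : 0 ≤ distInt ν := Real.iInf_nonneg fun k => abs_nonneg _
  have h1 : distInt ν ≤ |ν - n| :=
    ciInf_le ⟨0, by rintro _ ⟨k, rfl⟩; exact abs_nonneg _⟩ n
  calc distInt ν ^ 2 ≤ |ν - n| ^ 2 := by gcongr
    _ = (n - ν) ^ 2 := by rw [sq_abs]; ring

lemma neg_pi_lt_pi : -Real.pi < Real.pi := by linarith [Real.pi_pos]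

lemma fourierCoeffOn_sub_of_continuous {a b : ℝ} (hab : a < b) {f g : ℝ → ℂ}
    (hf : Continuous f) (hg : Continuous g) (n : ℤ) :
    fourierCoeffOn hab (fun t => f t - g t) n = fourierCoeffOn hab f n - fourierCoeffOn hab g n := by
  have he : Continuous fun x : ℝ => fourier (-n) (x : AddCircle (b - a)) :=
    (fourier (-n)).continuous.comp (AddCircle.continuous_mk' _)
  simp only [fourierCoeffOn_eq_integral, smul_eq_mul, mul_sub]
  have hef : Continuous fun x : ℝ => fourier (-n) (x : AddCircle (b - a)) * f x := he.mul hf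
  have heg : Continuous fun x : ℝ => fourier (-n) (x : AddCircle (b - a)) * g x := he.mul hg
  rw [intervalIntegral.integral_sub (hef.intervalIntegrable _ _) (heg.intervalIntegrable _ _),
    smul_sub]

lemma fourierCoeffOn_deriv_of_periodic {g g' : ℝ → ℂ} (hg : ∀ t, HasDerivAt g (g' t) t)
    (hg' : Continuous g') (hper : g Real.pi = g (-Real.pi)) (n : ℤ) :
    fourierCoeffOn neg_pi_lt_pi g' n = Complex.I * n * fourierCoeffOn neg_pi_lt_pi g n := by
  rcases eq_or_ne n 0 with rfl | hn
  · rw [fourierCoeffOn_eq_integral]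
    have h : ∫ x in (-Real.pi)..Real.pi, g' x = 0 := by
      rw [intervalIntegral.integral_eq_sub_of_hasDerivAt (fun t _ => hg t)
        (hg'.intervalIntegrable _ _), hper, sub_self]
    simp [h]
  · rw [fourierCoeffOn_of_hasDerivAt neg_pi_lt_pi hn (fun t _ => hg t)
      (hg'.intervalIntegrable _ _), hper]
    have hn' : (n : ℂ) ≠ 0 := by exact_mod_cast hn
    have hp : (Real.pi : ℂ) ≠ 0 := by exact_mod_cast Real.pi_ne_zero
    push_cast
    field_simp
    ring

/-- The Hardy inequality on the circle: the spectral gap of `d/dt - iν` on periodic functions. -/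
lemma circle_magnetic_poincare {g g' : ℝ → ℂ} (hg : ∀ t, HasDerivAt g (g' t) t)
    (hg' : Continuous g') (hper : g Real.pi = g (-Real.pi)) (ν : ℝ) :
    distInt ν ^ 2 * ∫ t in (-Real.pi)..Real.pi, ‖g t‖ ^ 2 ≤
      ∫ t in (-Real.pi)..Real.pi, ‖g' t - Complex.I * ν * g t‖ ^ 2 := by
  have hgc : Continuous g := continuous_iff_continuousAt.2 fun t => (hg t).continuousAt
  have hL2 : ∀ {f : ℝ → ℂ}, Continuous f →
      MemLp f 2 (volume.restrict (Set.Ioc (-Real.pi) Real.pi)) := fun {f} hf =>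
    (memLp_two_iff_integrable_sq_norm hf.aestronglyMeasurable).2
      (Continuous.integrableOn_Ioc (by fun_prop))
  have hhc : Continuous fun t => g' t - Complex.I * ν * g t := by fun_prop
  have hcoeff (n : ℤ) : fourierCoeffOn neg_pi_lt_pi (fun t => g' t - Complex.I * ν * g t) n =
      Complex.I * (n - ν) * fourierCoeffOn neg_pi_lt_pi g n := by
    rw [fourierCoeffOn_sub_of_continuous _ hg' (by fun_prop), fourierCoeffOn.const_mul,
      fourierCoeffOn_deriv_of_periodic hg hg' hper]
    ring
  have h1 := (hasSum_sq_fourierCoeffOn neg_pi_lt_pi (hL2 hgc)).mul_left (distInt ν ^ 2)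
  have h2 := hasSum_sq_fourierCoeffOn neg_pi_lt_pi (hL2 hhc)
  have h3 := hasSum_le (fun n => ?_) h1 h2
  · have hpos : 0 < (Real.pi - -Real.pi)⁻¹ := inv_pos.2 (by linarith [Real.pi_pos])
    rw [smul_eq_mul, smul_eq_mul, mul_left_comm] at h3
    exact le_of_mul_le_mul_left h3 hpos
  · have hnorm : ‖Complex.I * ((n : ℂ) - ν)‖ ^ 2 = (n - ν) ^ 2 := by
      rw [norm_mul, Complex.norm_I, one_mul]
      have : ((n : ℂ) - ν) = ((n - ν : ℝ) : ℂ) := by push_cast; rfl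
      rw [this, Complex.norm_real, Real.norm_eq_abs, sq_abs]
    rw [hcoeff, norm_mul, mul_pow, hnorm]
    exact mul_le_mul_of_nonneg_right (distInt_sq_le ν n) (by positivity)

/-- The point with polar coordinates `(r, θ)` centred at `x₀`. -/
noncomputable def polarPoint (x₀ : EuclideanSpace ℝ (Fin 2)) (r θ : ℝ) :
    EuclideanSpace ℝ (Fin 2) :=
  x₀ + !₂[r * Real.cos θ, r * Real.sin θ]

lemma norm_polarPoint_sub (x₀ : EuclideanSpace ℝ (Fin 2)) (r θ : ℝ) :
    ‖polarPoint x₀ r θ - x₀‖ = |r| := by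
  rw [polarPoint, add_sub_cancel_left, ← Real.sqrt_sq_eq_abs, EuclideanSpace.norm_eq,
    Fin.sum_univ_two]
  have : (r * Real.cos θ) ^ 2 + (r * Real.sin θ) ^ 2 = r ^ 2 := by
    linear_combination r ^ 2 * Real.sin_sq_add_cos_sq θ
  simp only [Real.norm_eq_abs, sq_abs]
  exact congrArg Real.sqrt this

lemma continuous_polarPoint (x₀ : EuclideanSpace ℝ (Fin 2)) :
    Continuous fun p : ℝ × ℝ => polarPoint x₀ p.1 p.2 := by
  unfold polarPoint
  refine continuous_const.add ((PiLp.continuous_toLp 2 _).comp ?_)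
  refine continuous_pi fun i => ?_
  fin_cases i <;> simp <;> fun_prop

lemma euclidean_two_eq (a b : ℝ) : (!₂[a, b] : EuclideanSpace ℝ (Fin 2)) =
    a • EuclideanSpace.single 0 1 + b • EuclideanSpace.single 1 1 := by
  ext i; fin_cases i <;> simp

lemma hasDerivAt_polarPoint (x₀ : EuclideanSpace ℝ (Fin 2)) (r θ : ℝ) :
    HasDerivAt (polarPoint x₀ r)
      ((-(r * Real.sin θ)) • EuclideanSpace.single 0 1 +
        (r * Real.cos θ) • EuclideanSpace.single 1 1) θ := by
  have h : polarPoint x₀ r = fun t => x₀ +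
      ((r * Real.cos t) • EuclideanSpace.single 0 1 +
        (r * Real.sin t) • EuclideanSpace.single 1 1) := by
    funext t; rw [polarPoint, euclidean_two_eq]
  rw [h]
  have hc := (((Real.hasDerivAt_cos θ).const_mul r).smul_const
    (EuclideanSpace.single (0 : Fin 2) (1 : ℝ)))
  have hs := (((Real.hasDerivAt_sin θ).const_mul r).smul_const
    (EuclideanSpace.single (1 : Fin 2) (1 : ℝ)))
  simpa using (hc.add hs).const_add x₀

lemma norm_rotation_sq_le (a b : ℂ) (s c : ℝ) (h : s ^ 2 + c ^ 2 = 1) :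
    ‖-(s : ℂ) * a + c * b‖ ^ 2 ≤ ‖a‖ ^ 2 + ‖b‖ ^ 2 := by
  simp only [Complex.sq_norm, Complex.normSq_apply]
  simp
  have h' : c ^ 2 = 1 - s ^ 2 := by linarith
  nlinarith [sq_nonneg (c * a.re + s * b.re), sq_nonneg (c * a.im + s * b.im),
    congrArg (· * (a.re ^ 2 + a.im ^ 2 + b.re ^ 2 + b.im ^ 2)) h]

/-- The tangential part of the magnetic gradient is bounded by the full magnetic gradient. -/
lemma tangential_le_magGradSq (x₀ : EuclideanSpace ℝ (Fin 2)) (ν : ℝ)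
    (u : EuclideanSpace ℝ (Fin 2) → ℂ) {r : ℝ} (hr : 0 < r) (θ : ℝ) :
    ‖fderiv ℝ u (polarPoint x₀ r θ) ((-(r * Real.sin θ)) • EuclideanSpace.single 0 1 +
        (r * Real.cos θ) • EuclideanSpace.single 1 1) -
      Complex.I * ν * u (polarPoint x₀ r θ)‖ ^ 2 ≤
    r ^ 2 * magGradSq (AB x₀ ν) u (polarPoint x₀ r θ) := by
  set x := polarPoint x₀ r θ with hx
  have hnorm : ‖x - x₀‖ = r := by rw [hx, norm_polarPoint_sub, abs_of_pos hr]
  have h0 : x 0 - x₀ 0 = r * Real.cos θ := by simp [hx, polarPoint]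
  have h1 : x 1 - x₀ 1 = r * Real.sin θ := by simp [hx, polarPoint]
  have hA0 : AB x₀ ν x 0 = -(ν * Real.sin θ / r) := by
    simp only [AB, hnorm, h1, if_true]; field_simp
  have hA1 : AB x₀ ν x 1 = ν * Real.cos θ / r := by
    simp only [AB, hnorm, h0]; simp; field_simp
  have key := norm_rotation_sq_le
    (fderiv ℝ u x (EuclideanSpace.single 0 1) - Complex.I * u x * (AB x₀ ν x 0))
    (fderiv ℝ u x (EuclideanSpace.single 1 1) - Complex.I * u x * (AB x₀ ν x 1))
    (Real.sin θ) (Real.cos θ) (Real.sin_sq_add_cos_sq θ)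
  have hrC : (r : ℂ) ≠ 0 := by exact_mod_cast hr.ne'
  have hsc : (Real.sin θ : ℂ) ^ 2 + (Real.cos θ : ℂ) ^ 2 = 1 := by
    exact_mod_cast Real.sin_sq_add_cos_sq θ
  have heq : fderiv ℝ u x ((-(r * Real.sin θ)) • EuclideanSpace.single 0 1 +
        (r * Real.cos θ) • EuclideanSpace.single 1 1) - Complex.I * ν * u x =
      r * (-(Real.sin θ : ℂ) *
        (fderiv ℝ u x (EuclideanSpace.single 0 1) - Complex.I * u x * (AB x₀ ν x 0)) +
        Real.cos θ *
        (fderiv ℝ u x (EuclideanSpace.single 1 1) - Complex.I * u x * (AB x₀ ν x 1))) := by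
    rw [map_add, map_smul, map_smul, hA0, hA1, Complex.real_smul, Complex.real_smul]
    push_cast at hsc ⊢
    field_simp
    linear_combination (Complex.I * ν * u x) * hsc
  rw [heq, norm_mul, mul_pow, Complex.norm_real, Real.norm_eq_abs, sq_abs, magGradSq,
    Fin.sum_univ_two]
  exact mul_le_mul_of_nonneg_left key (sq_nonneg r)

lemma setIntegral_ball_eq_polar (x₀ : EuclideanSpace ℝ (Fin 2)) (R : ℝ)
    (F : EuclideanSpace ℝ (Fin 2) → ℝ) :
    ∫ x in Metric.ball x₀ R, F x =
      ∫ p in Set.Ioo 0 R ×ˢ Set.Ioo (-Real.pi) Real.pi, p.1 * F (polarPoint x₀ p.1 p.2) := by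
  let G : EuclideanSpace ℝ (Fin 2) → ℝ := (Metric.ball x₀ R).indicator F
  have hT : Set.Ioo 0 R ×ˢ Set.Ioo (-Real.pi) Real.pi ⊆ polarCoord.target :=
    Set.prod_mono Set.Ioo_subset_Ioi_self le_rfl
  calc ∫ x in Metric.ball x₀ R, F x = ∫ x, G x := (integral_indicator measurableSet_ball).symm
    _ = ∫ x, G (x₀ + x) := (integral_add_left_eq_self G x₀).symm
    _ = ∫ y : Fin 2 → ℝ, G (x₀ + WithLp.toLp 2 y) :=
      ((PiLp.volume_preserving_toLp (Fin 2)).integral_comp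
        (MeasurableEquiv.toLp 2 _).measurableEmbedding (fun x => G (x₀ + x))).symm
    _ = ∫ q : ℝ × ℝ, G (x₀ + !₂[q.1, q.2]) :=
      ((volume_preserving_finTwoArrow ℝ).symm.integral_comp
        (MeasurableEquiv.finTwoArrow.symm.measurableEmbedding)
        (fun y : Fin 2 → ℝ => G (x₀ + WithLp.toLp 2 y))).symm
    _ = ∫ p in polarCoord.target, p.1 • G (polarPoint x₀ p.1 p.2) :=
      (integral_comp_polarCoord_symm fun q : ℝ × ℝ => G (x₀ + !₂[q.1, q.2])).symm
    _ = ∫ p in polarCoord.target, (Set.Ioo 0 R ×ˢ Set.Ioo (-Real.pi) Real.pi).indicator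
          (fun p => p.1 * F (polarPoint x₀ p.1 p.2)) p := by
      refine setIntegral_congr_fun polarCoord.open_target.measurableSet fun p hp => ?_
      have hp1 : 0 < p.1 := hp.1
      have hball : polarPoint x₀ p.1 p.2 ∈ Metric.ball x₀ R ↔ p.1 < R := by
        rw [mem_ball_iff_norm, norm_polarPoint_sub, abs_of_pos hp1]
      by_cases h : p.1 < R
      · have hmem : p ∈ Set.Ioo 0 R ×ˢ Set.Ioo (-Real.pi) Real.pi := ⟨⟨hp1, h⟩, hp.2⟩
        simp only [G]
        rw [Set.indicator_of_mem (hball.2 h), Set.indicator_of_mem hmem, smul_eq_mul]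
      · simp only [G]
        rw [Set.indicator_of_notMem (fun h' => h (hball.1 h')),
          Set.indicator_of_notMem (fun h' => h h'.1.2), smul_zero]
    _ = _ := by
      rw [setIntegral_indicator (measurableSet_Ioo.prod measurableSet_Ioo),
        Set.inter_eq_right.2 hT]

lemma VanishesNear.continuous_of_continuousAt {x₀ : EuclideanSpace ℝ (Fin 2)}
    {u : EuclideanSpace ℝ (Fin 2) → ℂ} (hvan : VanishesNear x₀ u)
    {F : EuclideanSpace ℝ (Fin 2) → ℝ} (hF : ∀ x, x ≠ x₀ → ContinuousAt F x)
    (h0 : ∀ x, (∀ᶠ y in nhds x, u y = 0) → F x = 0) : Continuous F := by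
  refine continuous_iff_continuousAt.2 fun x => ?_
  by_cases hx : x = x₀
  · subst hx
    obtain ⟨ε, hε, h⟩ := hvan
    have : F =ᶠ[nhds x] fun _ => 0 := by
      filter_upwards [Metric.ball_mem_nhds x hε] with y hy
      exact h0 y (Filter.mem_of_superset (Metric.isOpen_ball.mem_nhds hy) h)
    exact continuousAt_const.congr this.symm
  · exact hF x hx

lemma continuous_norm_sq_div {x₀ : EuclideanSpace ℝ (Fin 2)} {u : EuclideanSpace ℝ (Fin 2) → ℂ}
    (hu : Continuous u) (hvan : VanishesNear x₀ u) :
    Continuous fun x => ‖u x‖ ^ 2 / ‖x - x₀‖ ^ 2 := by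
  refine hvan.continuous_of_continuousAt (fun x hx => ?_) fun x h => by simp [h.self_of_nhds]
  have : ‖x - x₀‖ ^ 2 ≠ 0 := pow_ne_zero 2 (norm_ne_zero_iff.2 (sub_ne_zero.2 hx))
  fun_prop (disch := assumption)

lemma continuous_magGradSq_AB {x₀ : EuclideanSpace ℝ (Fin 2)} {u : EuclideanSpace ℝ (Fin 2) → ℂ}
    (hu : ContDiff ℝ 1 u) (hvan : VanishesNear x₀ u) (ν : ℝ) :
    Continuous (magGradSq (AB x₀ ν) u) := by
  refine hvan.continuous_of_continuousAt (fun x hx => ?_) fun x h => ?_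
  · have hn : ‖x - x₀‖ ^ 2 ≠ 0 := pow_ne_zero 2 (norm_ne_zero_iff.2 (sub_ne_zero.2 hx))
    have huc : Continuous u := hu.continuous
    have hd : Continuous (fderiv ℝ u) := hu.continuous_fderiv one_ne_zero
    unfold magGradSq AB
    simp only [Fin.sum_univ_two, if_true, one_ne_zero, if_false]
    fun_prop (disch := assumption)
  · have hf : fderiv ℝ u x = 0 := by
      have : u =ᶠ[nhds x] fun _ => 0 := h
      rw [this.fderiv_eq]; simp
    simp [magGradSq, hf, h.self_of_nhds]

lemma integrableOn_polar {x₀ : EuclideanSpace ℝ (Fin 2)} (R : ℝ)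
    {F : EuclideanSpace ℝ (Fin 2) → ℝ} (hF : Continuous F) :
    IntegrableOn (fun p : ℝ × ℝ => p.1 * F (polarPoint x₀ p.1 p.2))
      (Set.Ioo 0 R ×ˢ Set.Ioo (-Real.pi) Real.pi) (volume.prod volume) :=
  ((continuous_fst.mul (hF.comp (continuous_polarPoint x₀))).continuousOn.integrableOn_compact
    (isCompact_Icc.prod isCompact_Icc)).mono_set
      (Set.prod_mono Set.Ioo_subset_Icc_self Set.Ioo_subset_Icc_self)

/-- Magnetic Hardy inequality of Laptev–Weidl type for the Aharonov–Bohm potential. -/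
theorem magnetic_hardy (x₀ : EuclideanSpace ℝ (Fin 2)) (R : ℝ) (hR : 0 < R) (ν : ℝ)
    (u : EuclideanSpace ℝ (Fin 2) → ℂ) (hu : ContDiff ℝ (⊤ : ℕ∞) u) (hvan : VanishesNear x₀ u) :
    ∫ x in Metric.ball x₀ R, magGradSq (AB x₀ ν) u x ≥
      distInt ν ^ 2 * ∫ x in Metric.ball x₀ R, ‖u x‖ ^ 2 / ‖x - x₀‖ ^ 2 := by
  have hu1 : ContDiff ℝ 1 u := hu.of_le (by exact_mod_cast le_top)
  have hM := continuous_magGradSq_AB hu1 hvan ν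
  have hG := continuous_norm_sq_div hu1.continuous hvan
  have hd : Continuous (fderiv ℝ u) := hu1.continuous_fderiv one_ne_zero
  have hMi := integrableOn_polar (x₀ := x₀) R hM
  have hGi := integrableOn_polar (x₀ := x₀) R hG
  have hMi' := hMi
  have hGi' := hGi
  rw [IntegrableOn, ← Measure.prod_restrict] at hMi' hGi'
  rw [ge_iff_le, setIntegral_ball_eq_polar, setIntegral_ball_eq_polar, Measure.volume_eq_prod,
    setIntegral_prod _ hMi, setIntegral_prod _ hGi, ← integral_const_mul]
  refine setIntegral_mono_on (hGi'.integral_prod_left.const_mul _) hMi'.integral_prod_left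
    measurableSet_Ioo fun r hr => ?_
  have hr0 : 0 < r := hr.1
  have hpc : Continuous (polarPoint x₀ r) :=
    (continuous_polarPoint x₀).comp (Continuous.prodMk_right r)
  let g' : ℝ → ℂ := fun θ => fderiv ℝ u (polarPoint x₀ r θ)
    ((-(r * Real.sin θ)) • EuclideanSpace.single 0 1 +
      (r * Real.cos θ) • EuclideanSpace.single 1 1)
  have hg : ∀ θ, HasDerivAt (fun θ => u (polarPoint x₀ r θ)) (g' θ) θ := fun θ =>
    ((hu1.differentiable one_ne_zero _).hasFDerivAt).comp_hasDerivAt θ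
      (hasDerivAt_polarPoint x₀ r θ)
  have hg' : Continuous g' := (hd.comp hpc).clm_apply (by fun_prop)
  have huc : Continuous fun θ => u (polarPoint x₀ r θ) := hu1.continuous.comp hpc
  have hcirc := circle_magnetic_poincare hg hg' (by simp [polarPoint]) ν
  have hmono : ∫ θ in (-Real.pi)..Real.pi, ‖g' θ - Complex.I * ν * u (polarPoint x₀ r θ)‖ ^ 2 ≤
      ∫ θ in (-Real.pi)..Real.pi, r ^ 2 * magGradSq (AB x₀ ν) u (polarPoint x₀ r θ) :=
    intervalIntegral.integral_mono_on neg_pi_lt_pi.le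
      (Continuous.intervalIntegrable (by fun_prop) _ _)
      ((continuous_const.mul (hM.comp hpc)).intervalIntegrable _ _)
      fun θ _ => tangential_le_magGradSq x₀ ν u hr0 θ
  have h := hcirc.trans hmono
  rw [intervalIntegral.integral_const_mul, intervalIntegral.integral_of_le neg_pi_lt_pi.le,
    intervalIntegral.integral_of_le neg_pi_lt_pi.le, integral_Ioc_eq_integral_Ioo,
    integral_Ioc_eq_integral_Ioo] at h
  simp only [norm_polarPoint_sub, sq_abs, integral_const_mul, integral_div]
  calc _ = r⁻¹ * (distInt ν ^ 2 *
        ∫ θ in Set.Ioo (-Real.pi) Real.pi, ‖u (polarPoint x₀ r θ)‖ ^ 2) := by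
        field_simp
    _ ≤ r⁻¹ * (r ^ 2 * ∫ θ in Set.Ioo (-Real.pi) Real.pi,
        magGradSq (AB x₀ ν) u (polarPoint x₀ r θ)) := by gcongr
    _ = _ := by field_simp
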